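/- Let (M_n)_{n∈ℕ} ∈ {C1,C2}^ℕ be a primitive sequence and let f ∈ Δ be such that ⋂_{n≥0} M_{[0,n)} ℝ³_{≥0} = ℝ_{≥0} f. Then the sequence is recovered by iterating the continued fraction map: for every n ∈ ℕ, M_n = 𝖬(F_C^n(f)), i.e., M_n = C1 if the first coordinate of F_C^n(f) is ≥ its third coordinate, and M_n = C2 otherwise. -/

import Mathlib

open Matrix Filter MeasureTheory

noncomputable section

/-- The matrix `C1`. -/
def C1 : Matrix (Fin 3) (Fin 3) ℝ := !![1,1,0; 0,0,1; 0,1,0]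

/-- The matrix `C2`. -/
def C2 : Matrix (Fin 3) (Fin 3) ℝ := !![0,1,0; 1,0,0; 0,1,1]

/-- The product `M 0 * M 1 * ... * M (n-1)`. -/
def pprod (M : ℕ → Matrix (Fin 3) (Fin 3) ℝ) (n : ℕ) : Matrix (Fin 3) (Fin 3) ℝ :=
  ((List.range n).map M).prod

/-- The product `M r * M (r+1) * ... * M (s-1)`. -/
def segProd (M : ℕ → Matrix (Fin 3) (Fin 3) ℝ) (r s : ℕ) : Matrix (Fin 3) (Fin 3) ℝ :=
  ((List.range (s - r)).map (fun k => M (r + k))).prod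

/-- A sequence of nonnegative matrices is primitive if every tail has a finite
initial product with all entries positive. -/
def IsPrimitiveSeq (M : ℕ → Matrix (Fin 3) (Fin 3) ℝ) : Prop :=
  ∀ r : ℕ, ∃ s : ℕ, r < s ∧ ∀ i j, 0 < segProd M r s i j

/-- The image of the nonnegative orthant under `M`. -/
def cone (M : Matrix (Fin 3) (Fin 3) ℝ) : Set (Fin 3 → ℝ) :=
  {y | ∃ x : Fin 3 → ℝ, (∀ i, 0 ≤ x i) ∧ y = M.mulVec x}

/-- The ray generated by `f`. -/
def ray (f : Fin 3 → ℝ) : Set (Fin 3 → ℝ) := {y | ∃ t : ℝ, 0 ≤ t ∧ y = t • f}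

/-- The simplex of nonnegative vectors whose entries sum to 1. -/
def simplex : Set (Fin 3 → ℝ) := {x | (∀ i, 0 ≤ x i) ∧ x 0 + x 1 + x 2 = 1}

/-- The continued fraction map `F_C` on the nonnegative orthant. -/
def FC (x : Fin 3 → ℝ) : Fin 3 → ℝ :=
  if x 2 ≤ x 0 then ![x 0 - x 2, x 2, x 1] else ![x 1, x 0, x 2 - x 0]

/-- The matrix associated with `x`: `C1` if the first coordinate of `x` is at
least its third coordinate, and `C2` otherwise. -/
def matOf (x : Fin 3 → ℝ) : Matrix (Fin 3) (Fin 3) ℝ :=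
  if x 2 ≤ x 0 then C1 else C2

theorem pprod_succ (M : ℕ → Matrix (Fin 3) (Fin 3) ℝ) (n : ℕ) :
    pprod M (n + 1) = M 0 * pprod (fun k => M (k + 1)) n := by
  simp [pprod, List.range_succ_eq_map, Function.comp_def]

theorem segProd_eq_pprod (M : ℕ → Matrix (Fin 3) (Fin 3) ℝ) (r s : ℕ) :
    segProd M r s = pprod (fun k => M (r + k)) (s - r) := rfl

theorem IsPrimitiveSeq.shift {M : ℕ → Matrix (Fin 3) (Fin 3) ℝ} (h : IsPrimitiveSeq M) :
    IsPrimitiveSeq (fun k => M (k + 1)) := by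
  intro r
  obtain ⟨s, hs, hpos⟩ := h (r + 1)
  refine ⟨s - 1, by omega, ?_⟩
  have hlen : s - 1 - r = s - (r + 1) := by omega
  have hfun : (fun k => M (r + k + 1)) = fun k => M (r + 1 + k) := by
    funext k
    congr 1
    omega
  rw [segProd_eq_pprod] at hpos ⊢
  rwa [hlen, hfun]

/-- A positive matrix maps nonzero nonnegative vectors to positive vectors. -/
theorem pos_of_mem_cone {P : Matrix (Fin 3) (Fin 3) ℝ} (hP : ∀ i j, 0 < P i j)
    {x : Fin 3 → ℝ} (hx : x ∈ cone P) (hx0 : x ≠ 0) (i : Fin 3) : 0 < x i := by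
  obtain ⟨y, hy, rfl⟩ := hx
  obtain ⟨j, hj⟩ : ∃ j, y j ≠ 0 := by
    by_contra! h
    exact hx0 (by rw [show y = 0 from funext h, mulVec_zero])
  exact Finset.sum_pos' (fun k _ => mul_nonneg (hP i k).le (hy k))
    ⟨j, Finset.mem_univ j, mul_pos (hP i j) ((hy j).lt_of_ne' hj)⟩

theorem C1_mulVec (x : Fin 3 → ℝ) : C1.mulVec x = ![x 0 + x 1, x 2, x 1] := by
  ext i; fin_cases i <;> simp [C1, mulVec, dotProduct, Fin.sum_univ_three]

theorem C2_mulVec (x : Fin 3 → ℝ) : C2.mulVec x = ![x 1, x 0, x 1 + x 2] := by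
  ext i; fin_cases i <;> simp [C2, mulVec, dotProduct, Fin.sum_univ_three]

theorem mulVec_injective_of_eq {A : Matrix (Fin 3) (Fin 3) ℝ} (hA : A = C1 ∨ A = C2) :
    Function.Injective A.mulVec := by
  intro x y h
  rcases hA with rfl | rfl
  · simp only [C1_mulVec] at h
    have h0 := congrFun h 0
    have h1 := congrFun h 1
    have h2 := congrFun h 2
    simp at h0 h1 h2
    ext i; fin_cases i <;> simp <;> linarith
  · simp only [C2_mulVec] at h
    have h0 := congrFun h 0
    have h1 := congrFun h 1
    have h2 := congrFun h 2
    simp at h0 h1 h2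
    ext i; fin_cases i <;> simp <;> linarith

/-- On the image of a positive vector, the algorithm selects the right matrix and inverts it. -/
theorem matOf_FC_mulVec {A : Matrix (Fin 3) (Fin 3) ℝ} (hA : A = C1 ∨ A = C2)
    {x : Fin 3 → ℝ} (hx : ∀ i, 0 < x i) :
    matOf (A.mulVec x) = A ∧ FC (A.mulVec x) = x := by
  have p0 := hx 0
  have p2 := hx 2
  rcases hA with rfl | rfl
  · refine ⟨by simp [matOf, C1_mulVec, p0.le], ?_⟩
    ext i; fin_cases i <;> simp [FC, C1_mulVec, p0.le]
  · refine ⟨by simp [matOf, C2_mulVec, p2], ?_⟩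
    ext i; fin_cases i <;> simp [FC, C2_mulVec, p2.not_ge]

/-- A vector in all the nested cones is the image under `M 0` of a positive vector lying in all
the nested cones of the shifted sequence. -/
theorem exists_pos_mulVec_eq {M : ℕ → Matrix (Fin 3) (Fin 3) ℝ} (hM : ∀ n, M n = C1 ∨ M n = C2)
    (hprim : IsPrimitiveSeq M) {f : Fin 3 → ℝ} (hf : f ≠ 0) (hcone : ∀ n, f ∈ cone (pprod M n)) :
    ∃ x : Fin 3 → ℝ, (∀ i, 0 < x i) ∧ f = (M 0).mulVec x ∧
      ∀ n, x ∈ cone (pprod (fun k => M (k + 1)) n) := by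
  have key : ∀ n, ∃ x ∈ cone (pprod (fun k => M (k + 1)) n), f = (M 0).mulVec x := by
    intro n
    obtain ⟨y, hy, hfy⟩ := hcone (n + 1)
    exact ⟨_, ⟨y, hy, rfl⟩, by rw [hfy, pprod_succ, mulVec_mulVec]⟩
  obtain ⟨x, -, hfx⟩ := key 0
  have hx : ∀ n, x ∈ cone (pprod (fun k => M (k + 1)) n) := by
    intro n
    obtain ⟨y, hy, hfy⟩ := key n
    rwa [mulVec_injective_of_eq (hM 0) (hfx.symm.trans hfy)]
  have hx0 : x ≠ 0 := by
    rintro rfl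
    exact hf (by rw [hfx, mulVec_zero])
  obtain ⟨s, -, hpos⟩ := hprim.shift 0
  rw [segProd_eq_pprod] at hpos
  simp only [Nat.zero_add] at hpos
  exact ⟨x, pos_of_mem_cone hpos (hx _) hx0, hfx, hx⟩

theorem eq_matOf_iterate_FC (n : ℕ) {M : ℕ → Matrix (Fin 3) (Fin 3) ℝ}
    (hM : ∀ n, M n = C1 ∨ M n = C2) (hprim : IsPrimitiveSeq M) {f : Fin 3 → ℝ} (hf : f ≠ 0)
    (hcone : ∀ n, f ∈ cone (pprod M n)) : M n = matOf (FC^[n] f) := by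
  induction n generalizing M f with
  | zero =>
    obtain ⟨x, hx, rfl, -⟩ := exists_pos_mulVec_eq hM hprim hf hcone
    exact (matOf_FC_mulVec (hM 0) hx).1.symm
  | succ n ih =>
    obtain ⟨x, hx, rfl, hxc⟩ := exists_pos_mulVec_eq hM hprim hf hcone
    rw [Function.iterate_succ_apply, (matOf_FC_mulVec (hM 0) hx).2]
    exact ih (fun k => hM (k + 1)) hprim.shift (fun h => (hx 0).ne' (congrFun h 0)) hxc

theorem primitive_sequence_recovered_by_algorithm
    (M : ℕ → Matrix (Fin 3) (Fin 3) ℝ) (hM : ∀ n, M n = C1 ∨ M n = C2)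
    (hprim : IsPrimitiveSeq M)
    (f : Fin 3 → ℝ) (hf : f ∈ simplex)
    (hcone : (⋂ n : ℕ, cone (pprod M n)) = ray f) :
    ∀ n : ℕ, M n = matOf (FC^[n] f) := by
  have hf0 : f ≠ 0 := by
    rintro rfl
    simpa using hf.2
  have hmem : f ∈ ⋂ n : ℕ, cone (pprod M n) := hcone ▸ ⟨1, zero_le_one, (one_smul ℝ f).symm⟩
  exact fun n => eq_matOf_iterate_FC n hM hprim hf0 (Set.mem_iInter.mp hmem)
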